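/- There exist constants C > 0 and δ > 0 such that for all x ∈ (0,δ), | h_x″(z(x)) / ( −(1−α)·α^{−1/(1−α)}·x^{−1/(1−α)} ) − 1 | ≤ C·x^{α/(1−α)}; in other words, as x → 0⁺, h_x″(z(x)) = −( (1−α)/α^{1/(1−α)} ) · x^{−1/(1−α)} · (1 + O(x^{α/(1−α)})). -/

import Mathlib

/-- The function `h_x(z) = ln z - x ln(1-(1-z)^α)` for `z ∈ (0,1)`. -/
noncomputable def hfun (α x : ℝ) : ℝ → ℝ :=
  fun z => Real.log z - x * Real.log (1 - (1 - z) ^ α)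

/-- First derivative of `hfun` on `(0,1)`. -/
lemma hasDerivAt_hfun {α : ℝ} (hα : 0 < α) (x : ℝ) {z : ℝ} (hz : z ∈ Set.Ioo (0 : ℝ) 1) :
    HasDerivAt (hfun α x) (z⁻¹ - x * (α * (1 - z) ^ (α - 1) / (1 - (1 - z) ^ α))) z := by
  obtain ⟨hz0, hz1⟩ := hz
  have hw : 0 < 1 - z := by linarith
  have hu : (1 - z) ^ α < 1 := Real.rpow_lt_one hw.le (by linarith) hα
  have hsub : HasDerivAt (fun z : ℝ => 1 - z) (-1) z := by
    simpa using (hasDerivAt_id z).const_sub 1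
  have hpow := (hsub.rpow_const (p := α) (Or.inl hw.ne')).const_sub 1
  have hlog := hpow.log (by linarith)
  refine ((Real.hasDerivAt_log hz0.ne').sub (hlog.const_mul x)).congr_deriv ?_
  ring

/-- Second derivative of `hfun` on `(0,1)`. -/
lemma deriv_deriv_hfun {α : ℝ} (hα : 0 < α) (x : ℝ) {z : ℝ} (hz : z ∈ Set.Ioo (0 : ℝ) 1) :
    deriv (deriv (hfun α x)) z = -(z ^ 2)⁻¹ -
      x * (α * (1 - z) ^ (α - 1) / (1 - (1 - z) ^ α)) *
        ((1 - α) / (1 - z) - α * (1 - z) ^ (α - 1) / (1 - (1 - z) ^ α)) := by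
  have heq : deriv (hfun α x) =ᶠ[nhds z]
      fun z => z⁻¹ - x * (α * (1 - z) ^ (α - 1) / (1 - (1 - z) ^ α)) := by
    filter_upwards [Ioo_mem_nhds hz.1 hz.2] with y hy using (hasDerivAt_hfun hα x hy).deriv
  rw [heq.deriv_eq]
  obtain ⟨hz0, hz1⟩ := hz
  have hw : 0 < 1 - z := by linarith
  have hu : 0 < 1 - (1 - z) ^ α := by
    linarith [Real.rpow_lt_one hw.le (by linarith) hα]
  have hsub : HasDerivAt (fun z : ℝ => 1 - z) (-1) z := by
    simpa using (hasDerivAt_id z).const_sub 1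
  have hden := (hsub.rpow_const (p := α) (Or.inl hw.ne')).const_sub 1
  have hnum := (hsub.rpow_const (p := α - 1) (Or.inl hw.ne')).const_mul α
  have key := (hasDerivAt_inv hz0.ne').sub ((hnum.div hden hu.ne').const_mul x)
  refine (key.congr_deriv ?_).deriv
  rw [Real.rpow_sub_one hw.ne' (α - 1)]
  field_simp
  ring

/-- With `w = 1 - z`, the critical point equation of `hfun` in solved form. -/
lemma mul_eq_of_deriv_hfun_eq_zero {α x z : ℝ} (hα : 0 < α) (hz : z ∈ Set.Ioo (0 : ℝ) 1)
    (h : deriv (hfun α x) z = 0) :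
    α * x = (1 - z) ^ (1 - α) * ((1 - (1 - z) ^ α) / z) := by
  rw [(hasDerivAt_hfun hα x hz).deriv] at h
  obtain ⟨hz0, hz1⟩ := hz
  have hw : 0 < 1 - z := by linarith
  have hu : 0 < 1 - (1 - z) ^ α := by
    linarith [Real.rpow_lt_one hw.le (by linarith) hα]
  have hprod : (1 - z) ^ (1 - α) * (1 - z) ^ (α - 1) = 1 := by
    rw [← Real.rpow_add hw]; simp
  have hpos : 0 < (1 - z) ^ (1 - α) := Real.rpow_pos_of_pos hw _
  field_simp at h ⊢
  linear_combination (-(1 - z) ^ (1 - α)) * h - x * α * z * hprod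

/-- A factor in `[1 - p u, 1]` times a bracket `1 + O(p u)` is `1 + O(p u)`. -/
lemma abs_mul_bracket_sub_one_le {α p u w z R : ℝ} (hα0 : 0 < α) (hα1 : α < 1) (hp : 1 ≤ p)
    (hw0 : 0 < w) (hwu : w ≤ u) (hu : u ≤ 1 / 2) (hz : z = 1 - w) (hR0 : 0 ≤ R) (hR1 : R ≤ 1)
    (hR : 1 - p * u ≤ R) :
    |R * (1 / z + p * w / z ^ 2 - α * p * u / (z * (1 - u))) - 1| ≤ 11 * p * u := by
  have hu0 : 0 < u := hw0.trans_le hwu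
  have hz2 : 1 / 2 ≤ z := by linarith
  have hz0 : 0 < z := by linarith
  have hpu : u ≤ p * u := le_mul_of_one_le_left hu0.le hp
  have h1 : 1 / z - 1 ≤ 2 * u := by
    rw [sub_le_iff_le_add, div_le_iff₀ hz0]; nlinarith
  have h1' : 0 ≤ 1 / z - 1 := by
    rw [sub_nonneg, le_div_iff₀ hz0]; linarith
  have h2 : p * w / z ^ 2 ≤ 4 * (p * u) := by
    rw [div_le_iff₀ (by positivity)]
    have hzz : 1 / 4 ≤ z ^ 2 := by nlinarith
    have hpw : p * w ≤ p * u := by gcongr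
    nlinarith
  have h2' : 0 ≤ p * w / z ^ 2 := by positivity
  have h1u : 0 < 1 - u := by linarith
  have h3 : α * p * u / (z * (1 - u)) ≤ 4 * (p * u) := by
    rw [div_le_iff₀ (by positivity)]
    have hzz : 1 / 4 ≤ z * (1 - u) := by nlinarith
    have hap : α * p * u ≤ p * u := by nlinarith
    nlinarith
  have h3' : 0 ≤ α * p * u / (z * (1 - u)) := by positivity
  set B := 1 / z + p * w / z ^ 2 - α * p * u / (z * (1 - u)) with hB
  have hBabs : |B - 1| ≤ 10 * (p * u) := abs_le.2 ⟨by linarith, by linarith⟩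
  have hRabs : |R - 1| ≤ p * u := abs_le.2 ⟨by linarith, by linarith⟩
  calc |R * B - 1| = |R * (B - 1) + (R - 1)| := by ring_nf
    _ ≤ |R * (B - 1)| + |R - 1| := abs_add_le _ _
    _ = R * |B - 1| + |R - 1| := by rw [abs_mul, abs_of_nonneg hR0]
    _ ≤ 1 * (10 * (p * u)) + p * u := by gcongr
    _ = 11 * p * u := by ring

/-- At a critical point `z` of `hfun α x` in `(0,1)`, one has `(1 - z) ^ α ≤ x ^ (α / (1 - α))`. -/
lemma one_sub_rpow_le_of_deriv_hfun_eq_zero {α x z : ℝ} (hα : α ∈ Set.Ioo (0 : ℝ) 1)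
    (hz : z ∈ Set.Ioo (0 : ℝ) 1) (h : deriv (hfun α x) z = 0) :
    (1 - z) ^ α ≤ x ^ (α / (1 - α)) := by
  have hcrit := mul_eq_of_deriv_hfun_eq_zero hα.1 hz h
  obtain ⟨hα0, hα1⟩ := hα
  obtain ⟨hz0, hz1⟩ := hz
  have hw : 0 < 1 - z := by linarith
  have ha : 0 < 1 - α := by linarith
  have hbern : (1 - z) ^ α ≤ 1 - α * z := by
    have := rpow_one_add_le_one_add_mul_self (s := -z) (by linarith) hα0.le hα1.le
    rw [← sub_eq_add_neg] at this
    linarith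
  have hr : α ≤ (1 - (1 - z) ^ α) / z := by
    rw [le_div_iff₀ hz0]; linarith
  have hpos : 0 < (1 - z) ^ (1 - α) := Real.rpow_pos_of_pos hw _
  have hle : (1 - z) ^ (1 - α) ≤ x := by
    have : (1 - z) ^ (1 - α) * α ≤ α * x := by rw [hcrit]; gcongr
    nlinarith
  calc (1 - z) ^ α = ((1 - z) ^ (1 - α)) ^ (α / (1 - α)) := by
        rw [← Real.rpow_mul hw.le]; congr 1; field_simp
    _ ≤ x ^ (α / (1 - α)) := Real.rpow_le_rpow hpos.le hle (by positivity)

/-- The normalised second derivative of `hfun` at a critical point. -/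
lemma deriv_deriv_hfun_div_eq {α x z : ℝ} (hα : α ∈ Set.Ioo (0 : ℝ) 1) (hx : 0 < x)
    (hz : z ∈ Set.Ioo (0 : ℝ) 1) (h : deriv (hfun α x) z = 0) :
    deriv (deriv (hfun α x)) z /
        (-((1 - α) * α ^ (-(1 / (1 - α))) * x ^ (-(1 / (1 - α))))) =
      ((1 - (1 - z) ^ α) / z) ^ (1 / (1 - α)) *
        (1 / z + 1 / (1 - α) * (1 - z) / z ^ 2 -
          α * (1 / (1 - α)) * (1 - z) ^ α / (z * (1 - (1 - z) ^ α))) := by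
  have hcrit := mul_eq_of_deriv_hfun_eq_zero hα.1 hz h
  have hfirst := h
  rw [(hasDerivAt_hfun hα.1 x hz).deriv, sub_eq_zero] at hfirst
  rw [deriv_deriv_hfun hα.1 x hz, ← hfirst]
  obtain ⟨hα0, hα1⟩ := hα
  obtain ⟨hz0, hz1⟩ := hz
  have hw : 0 < 1 - z := by linarith
  have ha : 0 < 1 - α := by linarith
  have hu : 0 < 1 - (1 - z) ^ α := by
    linarith [Real.rpow_lt_one hw.le (by linarith) hα0]
  have hr : 0 < (1 - (1 - z) ^ α) / z := by positivity
  have hscale : α ^ (-(1 / (1 - α))) * x ^ (-(1 / (1 - α))) =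
      ((1 - z) * ((1 - (1 - z) ^ α) / z) ^ (1 / (1 - α)))⁻¹ := by
    rw [← Real.mul_rpow hα0.le hx.le, hcrit, Real.rpow_neg (by positivity),
      Real.mul_rpow (by positivity) hr.le, ← Real.rpow_mul hw.le, mul_one_div_cancel ha.ne',
      Real.rpow_one]
  have hR : 0 < ((1 - (1 - z) ^ α) / z) ^ (1 / (1 - α)) := Real.rpow_pos_of_pos hr _
  rw [mul_assoc, hscale, Real.rpow_sub_one hw.ne']
  generalize ((1 - (1 - z) ^ α) / z) ^ (1 / (1 - α)) = R at hR ⊢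
  generalize (1 - z) ^ α = u at hu ⊢
  field_simp
  ring

/-- as `x → 0⁺`,
`h_x''(z(x)) = -((1-α)/α^{1/(1-α)}) x^{-1/(1-α)} (1 + O(x^{α/(1-α)}))`,
where `z(x)` is the unique critical point of `h_x` in `(0,1)`. -/
theorem second_derivative_at_saddle_asymptotics (α : ℝ)
    (hα : α ∈ Set.Ioo (0 : ℝ) 1) (zf : ℝ → ℝ)
    (hzf : ∀ x ∈ Set.Ioo (0 : ℝ) 1, zf x ∈ Set.Ioo (0 : ℝ) 1 ∧
      deriv (hfun α x) (zf x) = 0) :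
    ∃ C > (0 : ℝ), ∃ δ > (0 : ℝ), ∀ x : ℝ, 0 < x → x < δ →
      |deriv (deriv (hfun α x)) (zf x) /
          (-((1 - α) * α ^ (-(1 / (1 - α))) * x ^ (-(1 / (1 - α))))) - 1| ≤
        C * x ^ (α / (1 - α)) := by
  have ⟨hα0, hα1⟩ := hα
  have ha : 0 < 1 - α := by linarith
  refine ⟨11 * (1 / (1 - α)), by positivity, (1 / 2) ^ ((1 - α) / α), by positivity,
    fun x hx hxδ => ?_⟩
  have hx1 : x < 1 :=
    hxδ.trans (Real.rpow_lt_one (by norm_num) (by norm_num) (by positivity))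
  obtain ⟨hz, hcrit⟩ := hzf x ⟨hx, hx1⟩
  generalize zf x = z at hz hcrit ⊢
  have hut := one_sub_rpow_le_of_deriv_hfun_eq_zero hα hz hcrit
  have ht : x ^ (α / (1 - α)) ≤ 1 / 2 := by
    calc x ^ (α / (1 - α)) ≤ ((1 / 2 : ℝ) ^ ((1 - α) / α)) ^ (α / (1 - α)) :=
          Real.rpow_le_rpow hx.le hxδ.le (by positivity)
      _ = 1 / 2 := by
          rw [← Real.rpow_mul (by norm_num), div_mul_div_cancel₀ hα0.ne', div_self ha.ne',
            Real.rpow_one]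
  rw [deriv_deriv_hfun_div_eq hα hx hz hcrit]
  obtain ⟨hz0, hz1⟩ := hz
  have hw : 0 < 1 - z := by linarith
  have hp : 1 ≤ 1 / (1 - α) := by rw [le_div_iff₀ ha]; linarith
  have hwu : 1 - z ≤ (1 - z) ^ α := by
    simpa using Real.rpow_le_rpow_of_exponent_ge hw (by linarith) hα1.le
  have hu : 0 < 1 - (1 - z) ^ α := by linarith
  set r := (1 - (1 - z) ^ α) / z with hr
  have hr0 : 0 ≤ r := by positivity
  have hr1 : r ≤ 1 := by rw [hr, div_le_one hz0]; linarith
  have hru : 1 - (1 - z) ^ α ≤ r := by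
    rw [hr, le_div_iff₀ hz0]; nlinarith
  have hbern : 1 - 1 / (1 - α) * (1 - z) ^ α ≤ r ^ (1 / (1 - α)) := by
    have := one_add_mul_self_le_rpow_one_add (s := r - 1) (by linarith) hp
    rw [add_sub_cancel] at this
    nlinarith
  refine (abs_mul_bracket_sub_one_le hα0 hα1 hp hw hwu (hut.trans ht) (by ring)
    (by positivity) (Real.rpow_le_one hr0 hr1 (by positivity)) hbern).trans ?_
  gcongr
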